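/- There exists a universal constant C > 0 with the following property. For every integer d ≥ 1, every probability density p₀ on ℝ^d, every R > 0 with ∫_{‖x‖₂ < R} p₀(x) dx > 1/2, every t ∈ (0,1), and every y ∈ ℝ^d, the smoothed density q_t is twice differentiable at y and the Hessian of its logarithm satisfies the operator-norm bound ‖∇² log q_t(y)‖ ≤ C·( (‖y‖₂² + t·R²)/(1−t)² + d²/(1−t) ). -/

import Mathlib

open MeasureTheory Real

/-- The Gaussian kernel `G_t(y,x) = (2π(1−t))^{−d/2} exp(−‖y−√t·x‖²/(2(1−t)))`. -/
noncomputable def gaussKernel (d : ℕ) (t : ℝ) (y x : EuclideanSpace ℝ (Fin d)) : ℝ :=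
  (2 * π * (1 - t)) ^ (-(d : ℝ) / 2) *
    Real.exp (-‖y - Real.sqrt t • x‖ ^ 2 / (2 * (1 - t)))

/-- The smoothed density `q_t(y) = ∫ p₀(x) G_t(y,x) dx`. -/
noncomputable def smoothed (d : ℕ) (p₀ : EuclideanSpace ℝ (Fin d) → ℝ) (t : ℝ)
    (y : EuclideanSpace ℝ (Fin d)) : ℝ :=
  ∫ x, p₀ x * gaussKernel d t y x

/-- The posterior density `π_t(x|y) = p₀(x) G_t(y,x)/q_t(y)`. -/
noncomputable def post (d : ℕ) (p₀ : EuclideanSpace ℝ (Fin d) → ℝ) (t : ℝ)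
    (x y : EuclideanSpace ℝ (Fin d)) : ℝ :=
  p₀ x * gaussKernel d t y x / smoothed d p₀ t y

/-- The conditional reward `ρ_t(y) = ∫ r(x) π_t(x|y) dx`. -/
noncomputable def condReward (d : ℕ) (p₀ r : EuclideanSpace ℝ (Fin d) → ℝ) (t : ℝ)
    (y : EuclideanSpace ℝ (Fin d)) : ℝ :=
  ∫ x, r x * post d p₀ t x y

/-- The reward-reweighted density `p₀^r(x) = r(x)p₀(x)/∫ r p₀`. -/
noncomputable def reweighted (d : ℕ) (p₀ r : EuclideanSpace ℝ (Fin d) → ℝ)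
    (x : EuclideanSpace ℝ (Fin d)) : ℝ :=
  r x * p₀ x / ∫ x', r x' * p₀ x'

/-- A probability density on `ℝ^d`: measurable, nonnegative, integrating to one. -/
def IsDensity {d : ℕ} (p : EuclideanSpace ℝ (Fin d) → ℝ) : Prop :=
  Measurable p ∧ (∀ x, 0 ≤ p x) ∧ ∫ x, p x = 1

section Gaussian

variable {E : Type*} [NormedAddCommGroup E]

/-- The unnormalized Gaussian `exp (-‖v‖² / (2s))`. -/
noncomputable def gaussian (s : ℝ) (v : E) : ℝ := Real.exp (-‖v‖ ^ 2 / (2 * s))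

theorem gaussian_pos (s : ℝ) (v : E) : 0 < gaussian s v := Real.exp_pos _

theorem gaussian_le_one {s : ℝ} (hs : 0 < s) (v : E) : gaussian s v ≤ 1 := by
  refine Real.exp_le_one_iff.2 ?_
  rw [neg_div]
  exact neg_nonpos.2 (by positivity)

theorem continuous_gaussian (s : ℝ) : Continuous (gaussian s : E → ℝ) := by
  unfold gaussian
  fun_prop

theorem norm_sq_mul_gaussian_le {s : ℝ} (hs : 0 < s) {a : ℝ} (ha : 0 ≤ a) (v : E) :
    ‖v‖ ^ 2 * gaussian s v ≤ 2 * s * (2 * a * gaussian s v + Real.exp (-a)) := by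
  obtain ⟨w, hw⟩ : ∃ w, w = ‖v‖ ^ 2 / (2 * s) := ⟨_, rfl⟩
  have hw0 : 0 ≤ w := hw ▸ by positivity
  have hv : ‖v‖ ^ 2 = 2 * s * w := by rw [hw]; field_simp
  have hg : gaussian s v = Real.exp (-w) := by rw [gaussian, hw, neg_div]
  rw [hv, hg, mul_assoc]
  refine mul_le_mul_of_nonneg_left ?_ (by positivity)
  have hp := Real.exp_pos (-w)
  rcases le_total w (2 * a) with h | h
  · nlinarith [Real.exp_pos (-a)]
  · have h1 : w * Real.exp (-w) ≤ Real.exp (-(w / 2)) := by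
      have h2 : w ≤ Real.exp (w / 2) := by
        have := Real.quadratic_le_exp_of_nonneg (x := w / 2) (by positivity)
        nlinarith [sq_nonneg (w / 2 - 1)]
      calc w * Real.exp (-w) ≤ Real.exp (w / 2) * Real.exp (-w) := by gcongr
        _ = Real.exp (-(w / 2)) := by rw [← Real.exp_add]; ring_nf
    have h3 : Real.exp (-(w / 2)) ≤ Real.exp (-a) := Real.exp_le_exp.2 (by linarith)
    nlinarith [mul_nonneg ha hp.le]

theorem norm_sq_mul_gaussian_le_const {s : ℝ} (hs : 0 < s) (v : E) :
    ‖v‖ ^ 2 * gaussian s v ≤ 2 * s := by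
  simpa using norm_sq_mul_gaussian_le hs le_rfl v

theorem norm_mul_gaussian_le {s : ℝ} (hs : 0 < s) (v : E) :
    ‖v‖ * gaussian s v ≤ 1 + 2 * s := by
  nlinarith [norm_sq_mul_gaussian_le_const hs v, gaussian_le_one hs v, gaussian_pos s v,
    mul_nonneg (sq_nonneg (‖v‖ - 1)) (gaussian_pos s v).le,
    mul_nonneg (sq_nonneg ‖v‖) (gaussian_pos s v).le]

theorem norm_gaussian_le_one {s : ℝ} (hs : 0 < s) (v : E) : ‖gaussian s v‖ ≤ 1 := by
  rw [Real.norm_of_nonneg (gaussian_pos s v).le]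
  exact gaussian_le_one hs v

variable [InnerProductSpace ℝ E]

/-- The gradient of `gaussian s`. -/
noncomputable def gaussianGrad (s : ℝ) (v : E) : E := (-(gaussian s v / s)) • v

/-- The Hessian of `gaussian s`. -/
noncomputable def gaussianHess (s : ℝ) (v : E) : E →L[ℝ] E :=
  (-(gaussian s v / s)) • ContinuousLinearMap.id ℝ E +
    ((gaussian s v / s ^ 2) • innerSL ℝ v).smulRight v

theorem hasFDerivAt_gaussian (s : ℝ) (v : E) :
    HasFDerivAt (gaussian s) (innerSL ℝ (gaussianGrad s v)) v := by
  have h := (((hasStrictFDerivAt_norm_sq v).hasFDerivAt.neg).mul_const (2 * s)⁻¹).exp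
  refine h.congr_fderiv ?_
  ext w
  simp [gaussianGrad, gaussian, div_eq_mul_inv]
  ring

theorem hasFDerivAt_gaussianGrad (s : ℝ) (v : E) :
    HasFDerivAt (gaussianGrad s) (gaussianHess s v) v := by
  have h := (((hasFDerivAt_gaussian s v).mul_const s⁻¹).neg).smul (hasFDerivAt_id v)
  refine h.congr_fderiv ?_
  ext w
  simp [gaussianGrad, gaussianHess, div_eq_mul_inv]
  ring_nf

theorem continuous_gaussianGrad (s : ℝ) : Continuous (gaussianGrad s : E → E) :=
  continuous_iff_continuousAt.2 fun v => (hasFDerivAt_gaussianGrad s v).continuousAt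

theorem continuous_gaussianHess (s : ℝ) : Continuous (gaussianHess s : E → E →L[ℝ] E) := by
  have := continuous_gaussian (E := E) s
  unfold gaussianHess
  fun_prop

theorem norm_gaussianGrad {s : ℝ} (hs : 0 < s) (v : E) :
    ‖gaussianGrad s v‖ = ‖v‖ * gaussian s v / s := by
  rw [gaussianGrad, norm_smul, norm_neg, Real.norm_of_nonneg
    (div_nonneg (gaussian_pos s v).le hs.le)]
  ring

theorem norm_gaussianHess_le {s : ℝ} (hs : 0 < s) (v : E) :
    ‖gaussianHess s v‖ ≤ gaussian s v / s + ‖v‖ ^ 2 * gaussian s v / s ^ 2 := by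
  have hg := (gaussian_pos s v).le
  refine (norm_add_le _ _).trans (add_le_add ?_ ?_)
  · rw [norm_smul, norm_neg, Real.norm_of_nonneg (by positivity)]
    exact mul_le_of_le_one_right (by positivity) ContinuousLinearMap.norm_id_le
  · rw [ContinuousLinearMap.norm_smulRight_apply, norm_smul, innerSL_apply_norm,
      Real.norm_of_nonneg (by positivity)]
    exact le_of_eq (by ring)

theorem norm_gaussianGrad_le_const {s : ℝ} (hs : 0 < s) (v : E) :
    ‖gaussianGrad s v‖ ≤ (1 + 2 * s) / s := by
  rw [norm_gaussianGrad hs]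
  gcongr
  exact norm_mul_gaussian_le hs v

theorem norm_gaussianHess_le_const {s : ℝ} (hs : 0 < s) (v : E) :
    ‖gaussianHess s v‖ ≤ 1 / s + 2 * s / s ^ 2 := by
  refine (norm_gaussianHess_le hs v).trans ?_
  exact add_le_add (div_le_div_of_nonneg_right (gaussian_le_one hs v) hs.le)
    (div_le_div_of_nonneg_right (norm_sq_mul_gaussian_le_const hs v) (sq_nonneg s))

end Gaussian

section GaussianSmoothing

variable {E : Type*} [NormedAddCommGroup E] [InnerProductSpace ℝ E] [FiniteDimensional ℝ E]
  [MeasurableSpace E] [BorelSpace E]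

theorem integrable_comp_sub_of_bounded {F : Type*} [NormedAddCommGroup F]
    {ν : Measure E} [IsFiniteMeasure ν] {f : E → F}
    (hf : Continuous f) {K : ℝ} (hK : ∀ v, ‖f v‖ ≤ K) (y : E) :
    Integrable (fun u => f (y - u)) ν :=
  have hc : Continuous fun u => f (y - u) := by fun_prop
  Integrable.of_bound hc.aestronglyMeasurable K (ae_of_all _ fun _ => hK _)

variable {F : Type*} [NormedAddCommGroup F] [NormedSpace ℝ F]

theorem continuous_integral_comp_sub {ν : Measure E} [IsFiniteMeasure ν] {f : E → F}
    (hf : Continuous f) {K : ℝ} (hK : ∀ v, ‖f v‖ ≤ K) :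
    Continuous fun y => ∫ u, f (y - u) ∂ν :=
  continuous_of_dominated (fun y => (integrable_comp_sub_of_bounded hf hK y).aestronglyMeasurable)
    (fun _ => ae_of_all _ fun _ => hK _) (integrable_const K)
    (ae_of_all _ fun _ => by fun_prop)

theorem hasFDerivAt_integral_comp_sub {ν : Measure E} [IsFiniteMeasure ν] {f : E → F}
    {f' : E → E →L[ℝ] F} (hf : ∀ v, HasFDerivAt f (f' v) v) (hf' : Continuous f')
    {K K' : ℝ} (hK : ∀ v, ‖f v‖ ≤ K) (hK' : ∀ v, ‖f' v‖ ≤ K') (y : E) :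
    HasFDerivAt (fun z => ∫ u, f (z - u) ∂ν) (∫ u, f' (y - u) ∂ν) y := by
  have hfc : Continuous f := continuous_iff_continuousAt.2 fun v => (hf v).continuousAt
  refine hasFDerivAt_integral_of_dominated_of_fderiv_le (F := fun z u => f (z - u))
    (F' := fun z u => f' (z - u)) (bound := fun _ => K') Filter.univ_mem
    (Filter.Eventually.of_forall fun z =>
      (integrable_comp_sub_of_bounded hfc hK z).aestronglyMeasurable)
    (integrable_comp_sub_of_bounded hfc hK y)
    (integrable_comp_sub_of_bounded hf' hK' y).aestronglyMeasurable
    (ae_of_all _ fun _ _ _ => hK' _) (integrable_const K') (ae_of_all _ fun u z _ => ?_)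
  simpa [Function.comp_def] using (hf (z - u)).comp z ((hasFDerivAt_id z).sub_const u)

/-- The unnormalized Gaussian smoothing of a measure. -/
noncomputable def gaussianConv (s : ℝ) (ν : Measure E) (y : E) : ℝ := ∫ u, gaussian s (y - u) ∂ν

section Smoothness

variable {s : ℝ} {ν : Measure E} [IsFiniteMeasure ν]

theorem hasFDerivAt_integral_gaussianGrad (hs : 0 < s) (y : E) :
    HasFDerivAt (fun z => ∫ u, gaussianGrad s (z - u) ∂ν) (∫ u, gaussianHess s (y - u) ∂ν) y :=
  hasFDerivAt_integral_comp_sub (hasFDerivAt_gaussianGrad s) (continuous_gaussianHess s)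
    (norm_gaussianGrad_le_const hs) (norm_gaussianHess_le_const hs) y

theorem hasFDerivAt_gaussianConv (hs : 0 < s) (y : E) :
    HasFDerivAt (gaussianConv s ν) (innerSL ℝ (∫ u, gaussianGrad s (y - u) ∂ν)) y := by
  have h := hasFDerivAt_integral_comp_sub (ν := ν) (hasFDerivAt_gaussian (E := E) s)
    ((innerSL ℝ).continuous.comp (continuous_gaussianGrad s)) (norm_gaussian_le_one hs)
    (fun v => (innerSL_apply_norm ℝ (gaussianGrad s v)).le.trans
      (norm_gaussianGrad_le_const hs v)) y
  refine h.congr_fderiv ?_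
  exact (innerSL ℝ).integral_comp_comm (integrable_comp_sub_of_bounded
    (continuous_gaussianGrad s) (norm_gaussianGrad_le_const hs) y)

theorem contDiff_gaussianConv (hs : 0 < s) : ContDiff ℝ 2 (gaussianConv s ν) := by
  have hfd : fderiv ℝ (gaussianConv s ν) =
      fun y => innerSL ℝ (∫ u, gaussianGrad s (y - u) ∂ν) :=
    funext fun y => (hasFDerivAt_gaussianConv hs y).fderiv
  have hV : ContDiff ℝ 1 fun y => ∫ u, gaussianGrad s (y - u) ∂ν := by
    refine contDiff_one_iff_fderiv.2
      ⟨fun y => (hasFDerivAt_integral_gaussianGrad hs y).differentiableAt, ?_⟩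
    rw [funext fun y => (hasFDerivAt_integral_gaussianGrad (ν := ν) hs y).fderiv]
    exact continuous_integral_comp_sub (continuous_gaussianHess s) (norm_gaussianHess_le_const hs)
  rw [show (2 : WithTop ℕ∞) = 1 + 1 by norm_num, contDiff_succ_iff_fderiv]
  refine ⟨fun y => (hasFDerivAt_gaussianConv hs y).differentiableAt, by simp, ?_⟩
  rw [hfd]
  exact (innerSL ℝ).contDiff.comp hV

theorem integrable_gaussian_sub (hs : 0 < s) (y : E) :
    Integrable (fun u => gaussian s (y - u)) ν :=
  integrable_comp_sub_of_bounded (continuous_gaussian s) (norm_gaussian_le_one hs) y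

theorem gaussianConv_pos [NeZero ν] (hs : 0 < s) (y : E) : 0 < gaussianConv s ν y := by
  refine (integral_pos_iff_support_of_nonneg (fun u => (gaussian_pos s (y - u)).le)
    (integrable_gaussian_sub hs y)).2 ?_
  rw [Function.support_eq_univ fun u => (gaussian_pos s (y - u)).ne']
  exact Measure.measure_univ_pos.2 (NeZero.ne ν)

/-- The Hessian of `log (gaussianConv s ν)`. -/
noncomputable def logGaussianConvHess (s : ℝ) (ν : Measure E) (y : E) : E →L[ℝ] E :=
  (gaussianConv s ν y)⁻¹ • (∫ u, gaussianHess s (y - u) ∂ν) +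
    ((-((gaussianConv s ν y) ^ 2)⁻¹) • innerSL ℝ (∫ u, gaussianGrad s (y - u) ∂ν)).smulRight
      (∫ u, gaussianGrad s (y - u) ∂ν)

theorem hasGradientAt_log_const_mul_gaussianConv [NeZero ν] (hs : 0 < s) {c : ℝ} (hc : c ≠ 0)
    (y : E) : HasGradientAt (fun z => Real.log (c * gaussianConv s ν z))
      ((gaussianConv s ν y)⁻¹ • ∫ u, gaussianGrad s (y - u) ∂ν) y := by
  have hN := (gaussianConv_pos (ν := ν) hs y).ne'
  rw [hasGradientAt_iff_hasFDerivAt]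
  refine (((hasFDerivAt_gaussianConv hs y).const_mul c).log (mul_ne_zero hc hN)).congr_fderiv ?_
  ext w
  simp
  field_simp

theorem hasFDerivAt_gradient_log_const_mul_gaussianConv [NeZero ν] (hs : 0 < s) {c : ℝ}
    (hc : c ≠ 0) (y : E) :
    HasFDerivAt (gradient fun z => Real.log (c * gaussianConv s ν z))
      (logGaussianConvHess s ν y) y := by
  rw [funext fun z => (hasGradientAt_log_const_mul_gaussianConv (ν := ν) hs hc z).gradient]
  have hN := (gaussianConv_pos (ν := ν) hs y).ne'
  exact ((hasDerivAt_inv hN).comp_hasFDerivAt y (hasFDerivAt_gaussianConv hs y)).smul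
    (hasFDerivAt_integral_gaussianGrad hs y)

end Smoothness

section Bound

variable {s : ℝ} {ν : Measure E} [IsProbabilityMeasure ν]

theorem integrable_norm_sq_mul_gaussian_sub {ν : Measure E} [IsFiniteMeasure ν] (hs : 0 < s)
    (y : E) : Integrable (fun u => ‖y - u‖ ^ 2 * gaussian s (y - u)) ν := by
  refine integrable_comp_sub_of_bounded (f := fun v => ‖v‖ ^ 2 * gaussian s v) (K := 2 * s)
    ((continuous_norm.pow 2).mul (continuous_gaussian s)) (fun v => ?_) y
  rw [Real.norm_of_nonneg (mul_nonneg (sq_nonneg _) (gaussian_pos s v).le)]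
  exact norm_sq_mul_gaussian_le_const hs v

theorem exp_le_two_mul_gaussianConv (hs : 0 < s) {r : ℝ}
    (hr : 1 / 2 ≤ ν.real (Metric.ball 0 r)) (y : E) :
    Real.exp (-((‖y‖ + r) ^ 2 / (2 * s))) ≤ 2 * gaussianConv s ν y := by
  set e := Real.exp (-((‖y‖ + r) ^ 2 / (2 * s))) with he
  have hball : ∫ _ in Metric.ball (0 : E) r, e ∂ν ≤
      ∫ u in Metric.ball (0 : E) r, gaussian s (y - u) ∂ν := by
    refine setIntegral_mono_on (integrable_const e).integrableOn
      (integrable_gaussian_sub hs y).integrableOn measurableSet_ball fun u hu => ?_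
    rw [he, gaussian, neg_div]
    have hu' : ‖y - u‖ ≤ ‖y‖ + r :=
      (norm_sub_le y u).trans (by gcongr; exact (mem_ball_zero_iff.1 hu).le)
    gcongr
  have hle : ∫ u in Metric.ball (0 : E) r, gaussian s (y - u) ∂ν ≤ gaussianConv s ν y :=
    setIntegral_le_integral (integrable_gaussian_sub hs y)
      (ae_of_all _ fun u => (gaussian_pos s (y - u)).le)
  rw [setIntegral_const, smul_eq_mul] at hball
  nlinarith [Real.exp_pos (-((‖y‖ + r) ^ 2 / (2 * s)))]

theorem integral_norm_sq_mul_gaussian_le (hs : 0 < s) {r : ℝ}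
    (hr : 1 / 2 ≤ ν.real (Metric.ball 0 r)) (y : E) :
    ∫ u, ‖y - u‖ ^ 2 * gaussian s (y - u) ∂ν ≤
      (4 * (‖y‖ ^ 2 + r ^ 2) + 4 * s) * gaussianConv s ν y := by
  set a := (‖y‖ + r) ^ 2 / (2 * s) with ha
  have ha0 : 0 ≤ a := by positivity
  have hN := gaussianConv_pos (ν := ν) hs y
  have hig := integrable_gaussian_sub (ν := ν) hs y
  calc ∫ u, ‖y - u‖ ^ 2 * gaussian s (y - u) ∂ν
      ≤ ∫ u, 2 * s * (2 * a * gaussian s (y - u) + Real.exp (-a)) ∂ν :=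
        integral_mono (integrable_norm_sq_mul_gaussian_sub hs y)
          (((hig.const_mul _).add (integrable_const _)).const_mul _)
          fun u => norm_sq_mul_gaussian_le hs ha0 (y - u)
    _ = 2 * s * (2 * a * gaussianConv s ν y + Real.exp (-a)) := by
        rw [integral_const_mul, integral_add (hig.const_mul _) (integrable_const _),
          integral_const_mul]
        simp [gaussianConv]
    _ ≤ 2 * s * (2 * a * gaussianConv s ν y + 2 * gaussianConv s ν y) := by
        gcongr
        exact exp_le_two_mul_gaussianConv hs hr y
    _ = (2 * (‖y‖ + r) ^ 2 + 4 * s) * gaussianConv s ν y := by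
        rw [ha]
        field_simp
        ring
    _ ≤ _ := by
        refine mul_le_mul_of_nonneg_right ?_ hN.le
        nlinarith [sq_nonneg (‖y‖ - r)]

/-- A second moment bound for the posterior gives a first moment bound. -/
theorem integral_norm_mul_gaussian_le {ν : Measure E} [IsFiniteMeasure ν] (hs : 0 < s) {b : ℝ}
    (hb : 0 < b) {y : E} (h : ∫ u, ‖y - u‖ ^ 2 * gaussian s (y - u) ∂ν ≤
      b ^ 2 * gaussianConv s ν y) :
    ∫ u, ‖y - u‖ * gaussian s (y - u) ∂ν ≤ b * gaussianConv s ν y := by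
  have hig := integrable_gaussian_sub (ν := ν) hs y
  have hi2 := integrable_norm_sq_mul_gaussian_sub (ν := ν) hs y
  have hi1 : Integrable (fun u => ‖y - u‖ * gaussian s (y - u)) ν := by
    refine integrable_comp_sub_of_bounded (f := fun v => ‖v‖ * gaussian s v) (K := 1 + 2 * s)
      (continuous_norm.mul (continuous_gaussian s)) (fun v => ?_) y
    rw [Real.norm_of_nonneg (mul_nonneg (norm_nonneg _) (gaussian_pos s v).le)]
    exact norm_mul_gaussian_le hs v
  have hkey : 2 * b * ∫ u, ‖y - u‖ * gaussian s (y - u) ∂ν ≤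
      b ^ 2 * gaussianConv s ν y + ∫ u, ‖y - u‖ ^ 2 * gaussian s (y - u) ∂ν := by
    rw [gaussianConv, ← integral_const_mul, ← integral_const_mul,
      ← integral_add (hig.const_mul _) hi2]
    refine integral_mono (hi1.const_mul _) ((hig.const_mul _).add hi2) fun u => ?_
    have := mul_nonneg (sq_nonneg (‖y - u‖ - b)) (gaussian_pos s (y - u)).le
    linarith
  refine le_of_mul_le_mul_left ?_ (by positivity : 0 < 2 * b)
  linarith

theorem norm_logGaussianConvHess_le (hs : 0 < s) {r : ℝ}
    (hr : 1 / 2 ≤ ν.real (Metric.ball 0 r)) (y : E) :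
    ‖logGaussianConvHess s ν y‖ ≤ 9 * ((‖y‖ ^ 2 + r ^ 2) / s ^ 2 + 1 / s) := by
  have hN := gaussianConv_pos (ν := ν) hs y
  have hM := integral_norm_sq_mul_gaussian_le hs hr y
  set N := gaussianConv s ν y with hNdef
  have hB : 0 < 4 * (‖y‖ ^ 2 + r ^ 2) + 4 * s := by positivity
  set B := 4 * (‖y‖ ^ 2 + r ^ 2) + 4 * s with hBdef
  have hV : ‖∫ u, gaussianGrad s (y - u) ∂ν‖ ≤ √B * N / s := by
    calc ‖∫ u, gaussianGrad s (y - u) ∂ν‖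
        ≤ ∫ u, ‖gaussianGrad s (y - u)‖ ∂ν := norm_integral_le_integral_norm _
      _ = (∫ u, ‖y - u‖ * gaussian s (y - u) ∂ν) / s := by
          simp_rw [norm_gaussianGrad hs]
          rw [integral_div]
      _ ≤ √B * N / s := by
          gcongr
          refine integral_norm_mul_gaussian_le hs (Real.sqrt_pos.2 hB) ?_
          rwa [Real.sq_sqrt hB.le]
  have hA : ‖∫ u, gaussianHess s (y - u) ∂ν‖ ≤ N / s + B * N / s ^ 2 := by
    have hi1 := (integrable_gaussian_sub (ν := ν) hs y).div_const s
    have hi2 := (integrable_norm_sq_mul_gaussian_sub (ν := ν) hs y).div_const (s ^ 2)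
    calc ‖∫ u, gaussianHess s (y - u) ∂ν‖
        ≤ ∫ u, (gaussian s (y - u) / s + ‖y - u‖ ^ 2 * gaussian s (y - u) / s ^ 2) ∂ν :=
          norm_integral_le_of_norm_le (hi1.add hi2)
            (ae_of_all _ fun u => norm_gaussianHess_le hs (y - u))
      _ = N / s + (∫ u, ‖y - u‖ ^ 2 * gaussian s (y - u) ∂ν) / s ^ 2 := by
          rw [integral_add hi1 hi2, integral_div, integral_div, hNdef, gaussianConv]
      _ ≤ _ := by gcongr
  calc ‖logGaussianConvHess s ν y‖
      ≤ N⁻¹ * ‖∫ u, gaussianHess s (y - u) ∂ν‖ +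
          (N ^ 2)⁻¹ * ‖∫ u, gaussianGrad s (y - u) ∂ν‖ ^ 2 := by
        refine (norm_add_le _ _).trans (le_of_eq ?_)
        rw [ContinuousLinearMap.norm_smulRight_apply, norm_smul, norm_smul, innerSL_apply_norm,
          norm_neg, Real.norm_of_nonneg (inv_nonneg.2 hN.le),
          Real.norm_of_nonneg (inv_nonneg.2 (sq_nonneg N))]
        ring
    _ ≤ N⁻¹ * (N / s + B * N / s ^ 2) + (N ^ 2)⁻¹ * (√B * N / s) ^ 2 := by gcongr
    _ = 1 / s + 2 * B / s ^ 2 := by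
        rw [div_pow, mul_pow, Real.sq_sqrt hB.le]
        field_simp
        ring
    _ = 8 * ((‖y‖ ^ 2 + r ^ 2) / s ^ 2) + 9 * (1 / s) := by
        rw [hBdef]
        field_simp
        ring
    _ ≤ _ := by
        have : 0 ≤ (‖y‖ ^ 2 + r ^ 2) / s ^ 2 := by positivity
        linarith

end Bound

end GaussianSmoothing

section Density

variable {d : ℕ} {p₀ : EuclideanSpace ℝ (Fin d) → ℝ}

/-- The law of `√t • x` when `x` has density `p₀`. -/
noncomputable def scaledLaw (p₀ : EuclideanSpace ℝ (Fin d) → ℝ) (t : ℝ) :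
    Measure (EuclideanSpace ℝ (Fin d)) :=
  (volume.withDensity fun x => ENNReal.ofReal (p₀ x)).map fun x => √t • x

theorem IsDensity.integrable (h : IsDensity p₀) : Integrable p₀ :=
  Integrable.of_integral_ne_zero (by rw [h.2.2]; exact one_ne_zero)

theorem IsDensity.isProbabilityMeasure_withDensity (h : IsDensity p₀) :
    IsProbabilityMeasure (volume.withDensity fun x => ENNReal.ofReal (p₀ x)) := by
  constructor
  rw [withDensity_apply _ MeasurableSet.univ, Measure.restrict_univ,
    ← ofReal_integral_eq_lintegral_ofReal h.integrable (ae_of_all _ h.2.1), h.2.2,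
    ENNReal.ofReal_one]

theorem IsDensity.isProbabilityMeasure_scaledLaw (h : IsDensity p₀) (t : ℝ) :
    IsProbabilityMeasure (scaledLaw p₀ t) :=
  have := h.isProbabilityMeasure_withDensity
  Measure.isProbabilityMeasure_map (by fun_prop)

theorem IsDensity.integral_scaledLaw (h : IsDensity p₀) (t : ℝ)
    {f : EuclideanSpace ℝ (Fin d) → ℝ} (hf : Continuous f) :
    ∫ u, f u ∂(scaledLaw p₀ t) = ∫ x, p₀ x * f (√t • x) := by
  rw [scaledLaw, integral_map (by fun_prop) hf.aestronglyMeasurable,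
    integral_withDensity_eq_integral_toReal_smul h.1.ennreal_ofReal (by simp)]
  simp [ENNReal.toReal_ofReal (h.2.1 _)]

theorem IsDensity.smoothed_eq (h : IsDensity p₀) (t : ℝ) :
    smoothed d p₀ t = fun y =>
      (2 * π * (1 - t)) ^ (-(d : ℝ) / 2) * gaussianConv (1 - t) (scaledLaw p₀ t) y := by
  funext y
  have hc := continuous_gaussian (E := EuclideanSpace ℝ (Fin d)) (1 - t)
  rw [gaussianConv, h.integral_scaledLaw t (f := fun u => gaussian (1 - t) (y - u)) (by fun_prop),
    ← integral_const_mul, smoothed]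
  congr 1 with x
  rw [gaussKernel, gaussian]
  ring

theorem IsDensity.scaledLaw_ball (h : IsDensity p₀) {t : ℝ} (ht : 0 < t) (R : ℝ) :
    (scaledLaw p₀ t).real (Metric.ball 0 (√t * R)) =
      ∫ x in {x : EuclideanSpace ℝ (Fin d) | ‖x‖ < R}, p₀ x := by
  have hset : (fun x : EuclideanSpace ℝ (Fin d) => √t • x) ⁻¹' Metric.ball 0 (√t * R) =
      {x | ‖x‖ < R} := by
    ext x
    simp [norm_smul, abs_of_nonneg (Real.sqrt_nonneg t), Real.sqrt_pos.2 ht]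
  have hm : MeasurableSet {x : EuclideanSpace ℝ (Fin d) | ‖x‖ < R} :=
    measurableSet_lt measurable_norm measurable_const
  rw [scaledLaw, map_measureReal_apply (by fun_prop) measurableSet_ball, hset, measureReal_def,
    withDensity_apply _ hm, ← ofReal_integral_eq_lintegral_ofReal h.integrable.integrableOn
      (ae_of_all _ h.2.1), ENNReal.toReal_ofReal (integral_nonneg h.2.1)]

end Density

/-- Universal Hessian bound for the log smoothed density: there is a
universal constant `C > 0` such that `q_t` is twice differentiable at every `y` and the
Hessian of `log q_t` satisfies `‖∇² log q_t(y)‖ ≤ C·((‖y‖²+t·R²)/(1−t)² + d²/(1−t))`. -/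
theorem stmt_9 :
    ∃ C : ℝ, 0 < C ∧
      ∀ (d : ℕ), 1 ≤ d →
      ∀ p₀ : EuclideanSpace ℝ (Fin d) → ℝ, IsDensity p₀ →
      ∀ R : ℝ, 0 < R →
        (1 / 2 < ∫ x in {x : EuclideanSpace ℝ (Fin d) | ‖x‖ < R}, p₀ x) →
      ∀ t : ℝ, t ∈ Set.Ioo (0 : ℝ) 1 →
      ∀ y : EuclideanSpace ℝ (Fin d),
        ContDiffAt ℝ 2 (fun z => smoothed d p₀ t z) y ∧
        ∃ H : EuclideanSpace ℝ (Fin d) →L[ℝ] EuclideanSpace ℝ (Fin d),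
          HasFDerivAt (fun z => gradient (fun w => Real.log (smoothed d p₀ t w)) z) H y ∧
          ‖H‖ ≤ C * ((‖y‖ ^ 2 + t * R ^ 2) / (1 - t) ^ 2 + d ^ 2 / (1 - t)) := by
  refine ⟨9, by norm_num, fun d hd p₀ hp R _ hR t ht y => ?_⟩
  have hs : 0 < 1 - t := sub_pos.2 ht.2
  have := hp.isProbabilityMeasure_scaledLaw t
  have hc : (2 * π * (1 - t)) ^ (-(d : ℝ) / 2) ≠ 0 := (Real.rpow_pos_of_pos (by positivity) _).ne'
  rw [hp.smoothed_eq t]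
  refine ⟨(contDiff_const.mul (contDiff_gaussianConv hs)).contDiffAt, _,
    hasFDerivAt_gradient_log_const_mul_gaussianConv hs hc y, ?_⟩
  refine (norm_logGaussianConvHess_le hs (r := √t * R) ?_ y).trans ?_
  · rw [hp.scaledLaw_ball ht.1]
    exact hR.le
  · rw [mul_pow, Real.sq_sqrt ht.1.le]
    gcongr
    exact_mod_cast Nat.one_le_pow 2 d hd
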